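/- Let G be a concurrent stochastic game with countable state set S, a sink target state ⊤, and with B(s) finite for every s ∈ S. If σ is a Max strategy that is optimal for Reach(⊤) from state s, then the mixed action σ(s) is optimality-preserving: for every b ∈ B(s), ⟨p(s,σ(s),b), val(Reach(⊤), ·)⟩ ≥ val(Reach(⊤), s), and whenever ⟨p(s,σ(s),b), val(Reach(⊤), ·)⟩ = val(Reach(⊤), s), every state in the support of p(s,σ(s),b) admits an optimal Max strategy for Reach(⊤). -/

import Mathlib

open scoped ENNReal Classical

/-- One step of a play: a state together with the actions chosen by Max and Min there. -/
structure Step (S A B : Type) where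
  st : S
  ac : A
  bc : B

instance {S A B : Type} : MeasurableSpace (Step S A B) := ⊤

/-- A history: the list of past steps together with the current (final) state. -/
abbrev Hist (S A B : Type) := List (Step S A B) × S

/-- An infinite play. -/
abbrev Play (S A B : Type) := ℕ → Step S A B

/-- A concurrent stochastic game: action sets for Max and Min at each state
(nonempty; countability is imposed via `Countable` instances on `S`, `A`, `B`),
and a transition probability distribution for each state and pair of actions. -/
structure Game (S A B : Type) where
  actA : S → Set A
  actB : S → Set B
  actA_nonempty : ∀ s, (actA s).Nonempty
  actB_nonempty : ∀ s, (actB s).Nonempty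
  p : S → A → B → PMF S

namespace Game

variable {S A B : Type}

/-- A Max strategy assigns to each history a mixed action on the Max actions
available at the final state of the history. -/
def IsMaxStrategy (G : Game S A B) (σ : Hist S A B → PMF A) : Prop :=
  ∀ h : Hist S A B, (σ h).support ⊆ G.actA h.2

/-- A Min strategy assigns to each history a mixed action on the Min actions
available at the final state of the history. -/
def IsMinStrategy (G : Game S A B) (π : Hist S A B → PMF B) : Prop :=
  ∀ h : Hist S A B, (π h).support ⊆ G.actB h.2

/-- A sink state: all transitions from it return to it with probability 1. -/
def IsSink (G : Game S A B) (s : S) : Prop := ∀ a b, G.p s a b s = 1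

/-- A history is valid if all actions taken in it were available. -/
def ValidHist (G : Game S A B) (h : Hist S A B) : Prop :=
  ∀ z ∈ h.1, z.ac ∈ G.actA z.st ∧ z.bc ∈ G.actB z.st

/-- Transition function extended to a mixed Max action and a pure Min action. -/
noncomputable def pA (G : Game S A B) (s : S) (α : PMF A) (b : B) : PMF S :=
  α.bind fun a => G.p s a b

/-- Transition function extended to mixed actions of both players. -/
noncomputable def pAB (G : Game S A B) (s : S) (α : PMF A) (β : PMF B) : PMF S :=
  α.bind fun a => β.bind fun b => G.p s a b

/-- The state reached after the current position: the state of the next listed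
step, or the given final state if no steps remain. -/
def nextState : List (Step S A B) → S → S
  | [], t => t
  | z :: _, _ => z.st

/-- Auxiliary recursion computing the probability of a history:
`pre` is the already-consumed prefix, `cur` the current state, and the
remaining steps and final state are processed from the left. -/
noncomputable def histProbAux (G : Game S A B)
    (σ : Hist S A B → PMF A) (π : Hist S A B → PMF B) :
    List (Step S A B) → S → List (Step S A B) → S → ℝ≥0∞
  | _, cur, [], t => if t = cur then 1 else 0
  | pre, cur, z :: rest, t =>
    if z.st = cur then
      σ (pre, cur) z.ac * π (pre, cur) z.bc *
        G.p z.st z.ac z.bc (nextState rest t) *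
        histProbAux G σ π (pre ++ [z]) (nextState rest t) rest t
    else 0

/-- The probability of (the cylinder of) a history under strategies σ, π from
initial state `s0`. -/
noncomputable def histProb (G : Game S A B)
    (σ : Hist S A B → PMF A) (π : Hist S A B → PMF B) (s0 : S) (h : Hist S A B) : ℝ≥0∞ :=
  G.histProbAux σ π [] s0 h.1 h.2

end Game

/-- The cylinder set of plays extending a given history. -/
def cylinder {S A B : Type} (h : Hist S A B) : Set (Play S A B) :=
  {ω | (∀ i : Fin h.1.length, ω i = h.1.get i) ∧ (ω h.1.length).st = h.2}

/-- A strategy is memoryless if its choice depends only on the final state. -/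
def Memoryless {S A B X : Type} (σ : Hist S A B → X) : Prop :=
  ∀ h h' : Hist S A B, h.2 = h'.2 → σ h = σ h'

/-- The event that the play visits state `t`. -/
def Reaches {S A B : Type} (t : S) : Set (Play S A B) := {ω | ∃ i, (ω i).st = t}

/-- The event that the play never visits state `t`. -/
def Avoids {S A B : Type} (t : S) : Set (Play S A B) := {ω | ∀ i, (ω i).st ≠ t}

/-- The event that the play visits state `t` within at most `n` steps. -/
def ReachesWithin {S A B : Type} (t : S) (n : ℕ) : Set (Play S A B) :=
  {ω | ∃ i ≤ n, (ω i).st = t}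

/-- Expectation of `v : S → ℝ≥0∞` with respect to a distribution on `S`. -/
noncomputable def expE {S : Type} (μ : PMF S) (v : S → ℝ≥0∞) : ℝ≥0∞ := ∑' t, μ t * v t

/-- Expectation of a real-valued `v` with respect to a distribution on `S`. -/
noncomputable def expR {S : Type} (μ : PMF S) (v : S → ℝ) : ℝ := ∑' t, (μ t).toReal * v t

/-- The mass a distribution assigns to a set of states. -/
noncomputable def massOf {S : Type} (μ : PMF S) (T : Set S) : ℝ≥0∞ :=
  ∑' t, T.indicator (⇑μ) t

namespace Game

variable {S A B : Type}

/-- `μ` is the probability measure on plays induced by strategies σ, π from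
initial state `s0` (characterized on cylinder sets, by Carathéodory's
extension theorem). -/
def IsPlayMeasure (G : Game S A B) (σ : Hist S A B → PMF A) (π : Hist S A B → PMF B)
    (s0 : S) (μ : MeasureTheory.Measure (Play S A B)) : Prop :=
  MeasureTheory.IsProbabilityMeasure μ ∧
    ∀ h : Hist S A B, μ (cylinder h) = G.histProb σ π s0 h

/-- The (lower) value `sup_σ inf_π P_{s,σ,π}(E)` of objective `E` from state `s`,
relative to the family `P` of induced play measures. -/
noncomputable def val (G : Game S A B)
    (P : (Hist S A B → PMF A) → (Hist S A B → PMF B) → S →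
      MeasureTheory.Measure (Play S A B))
    (E : Set (Play S A B)) (s : S) : ℝ≥0∞ :=
  ⨆ σ ∈ {σ | G.IsMaxStrategy σ}, ⨅ π ∈ {π | G.IsMinStrategy π}, P σ π s E

/-- The set of states from which Max has an optimal strategy for `Reaches top`. -/
def OptStates (G : Game S A B)
    (P : (Hist S A B → PMF A) → (Hist S A B → PMF B) → S →
      MeasureTheory.Measure (Play S A B))
    (top : S) : Set S :=
  {s | ∃ σ, G.IsMaxStrategy σ ∧ ∀ π, G.IsMinStrategy π →
      P σ π s (Reaches top) ≥ G.val P (Reaches top) s}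

/-- A mixed Max action `α` at `s` is optimality-preserving if every Min action
gives expected value at least the value of `s`, and in case of equality the
successor distribution is supported on states admitting optimal strategies. -/
def OptPreserving (G : Game S A B)
    (P : (Hist S A B → PMF A) → (Hist S A B → PMF B) → S →
      MeasureTheory.Measure (Play S A B))
    (top : S) (s : S) (α : PMF A) : Prop :=
  ∀ b ∈ G.actB s,
    G.val P (Reaches top) s ≤ expE (G.pA s α b) (G.val P (Reaches top)) ∧
    (expE (G.pA s α b) (G.val P (Reaches top)) = G.val P (Reaches top) s →
      (G.pA s α b).support ⊆ G.OptStates P top)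

/-- A Min action `b` is value-preserving at `s` against the mixed action `α`. -/
def ValuePres (G : Game S A B)
    (P : (Hist S A B → PMF A) → (Hist S A B → PMF B) → S →
      MeasureTheory.Measure (Play S A B))
    (top : S) (s : S) (α : PMF A) (b : B) : Prop :=
  expE (G.pA s α b) (G.val P (Reaches top)) = G.val P (Reaches top) s

end Game

instance Step.instCountable {S A B : Type} [Countable S] [Countable A] [Countable B] :
    Countable (Step S A B) :=
  Function.Injective.countable (f := fun z : Step S A B => (z.st, z.ac, z.bc)) (by
    rintro ⟨_, _, _⟩ ⟨_, _, _⟩ h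
    simpa using h)

theorem measurableSet_cylinder {S A B : Type} (h : Hist S A B) :
    MeasurableSet (cylinder h) := by
  have hz (i : ℕ) (T : Set (Step S A B)) : MeasurableSet {ω : Play S A B | ω i ∈ T} :=
    measurable_pi_apply i (MeasurableSpace.measurableSet_top (s := T))
  have : cylinder h = (⋂ i : Fin h.1.length, {ω : Play S A B | ω i ∈ ({h.1.get i} : Set _)}) ∩
      {ω : Play S A B | ω h.1.length ∈ {z | z.st = h.2}} := by
    ext ω
    simp [cylinder]
  rw [this]
  exact (MeasurableSet.iInter fun i => hz _ _).inter (hz _ _)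

/-- The lists of steps none of which starts at `t`. -/
def avoidingLists {S A B : Type} (t : S) : Set (List (Step S A B)) :=
  {l | ∀ z ∈ l, z.st ≠ t}

theorem mem_cylinder_iff {S A B : Type} (l : List (Step S A B)) (t : S) (ω : Play S A B) :
    ω ∈ cylinder (l, t) ↔ l = List.ofFn (fun i : Fin l.length => ω i) ∧ (ω l.length).st = t := by
  refine and_congr ⟨fun h => ?_, fun h i => ?_⟩ Iff.rfl
  · refine List.ext_get (by simp) fun n h₁ h₂ => ?_
    simpa using (h ⟨n, h₁⟩).symm
  · have := List.get_of_eq h i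
    simpa using this.symm

theorem reaches_eq_iUnion_cylinder {S A B : Type} (t : S) :
    (Reaches t : Set (Play S A B)) = ⋃ l : avoidingLists t, cylinder (l.1, t) := by
  ext ω
  simp only [Set.mem_iUnion]
  constructor
  · intro h
    have h' : ∃ i, (ω i).st = t := h
    refine ⟨⟨List.ofFn fun i : Fin (Nat.find h') => ω i, ?_⟩, ?_⟩
    · intro z hz
      obtain ⟨i, rfl⟩ := (List.mem_ofFn' _ _).1 hz
      exact Nat.find_min h' i.2
    · rw [mem_cylinder_iff]
      refine ⟨List.ext_get (by simp) fun n h₁ h₂ => by simp, ?_⟩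
      simpa using Nat.find_spec h'
  · rintro ⟨l, hl⟩
    exact ⟨_, hl.2⟩

theorem pairwise_disjoint_cylinder {S A B : Type} (t : S) :
    Pairwise (Function.onFun Disjoint
      fun l : avoidingLists t => (cylinder (l.1, t) : Set (Play S A B))) := by
  have key (l l' : avoidingLists t) (ω : Play S A B) (h : ω ∈ cylinder (l.1, t))
      (h' : ω ∈ cylinder (l'.1, t)) : l'.1.length ≤ l.1.length := by
    by_contra! hlt
    refine l'.2 _ (List.get_mem l'.1 ⟨l.1.length, hlt⟩) ?_
    rw [← h'.1 ⟨l.1.length, hlt⟩]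
    exact h.2
  intro l l' hne
  refine Set.disjoint_left.2 fun ω h h' => hne ?_
  have hlen := le_antisymm (key l' l ω h' h) (key l l' ω h h')
  refine Subtype.ext (List.ext_get hlen fun n h₁ h₂ => ?_)
  rw [← h.1 ⟨n, h₁⟩, ← h'.1 ⟨n, h₂⟩]

namespace Game

variable {S A B : Type}

/-- The probability of reaching `top`, as a sum over the histories that end with the first
visit to `top`. -/
noncomputable def reachSum (G : Game S A B) (σ : Hist S A B → PMF A) (π : Hist S A B → PMF B)
    (top s : S) : ℝ≥0∞ :=
  ∑' l, (avoidingLists top).indicator (fun l => G.histProbAux σ π [] s l top) l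

theorem IsPlayMeasure.reaches_eq [Countable S] [Countable A] [Countable B] {G : Game S A B}
    {σ : Hist S A B → PMF A} {π : Hist S A B → PMF B} {s : S}
    {μ : MeasureTheory.Measure (Play S A B)} (h : G.IsPlayMeasure σ π s μ) (top : S) :
    μ (Reaches top) = G.reachSum σ π top s := by
  rw [reaches_eq_iUnion_cylinder, MeasureTheory.measure_iUnion (pairwise_disjoint_cylinder top)
    fun l => measurableSet_cylinder _, reachSum, ← tsum_subtype]
  exact tsum_congr fun l => h.2 _

theorem histProbAux_cons_prefix (G : Game S A B) {σ σ' : Hist S A B → PMF A}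
    {π π' : Hist S A B → PMF B} (w : Step S A B) (x : S)
    (hσ : ∀ l u, nextState l u = x → σ (w :: l, u) = σ' (l, u))
    (hπ : ∀ l u, nextState l u = x → π (w :: l, u) = π' (l, u)) (t : S)
    (l pre : List (Step S A B)) (cur : S) (h : nextState pre cur = x) :
    G.histProbAux σ π (w :: pre) cur l t = G.histProbAux σ' π' pre cur l t := by
  induction l generalizing pre cur with
  | nil => rfl
  | cons z rest ih =>
    simp only [histProbAux]
    split_ifs with hz
    · rw [hσ _ _ h, hπ _ _ h, List.cons_append, ih]
      cases pre with
      | nil => exact hz.trans h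
      | cons y pre => exact h
    · rfl

theorem histProbAux_eq_zero (G : Game S A B) (σ : Hist S A B → PMF A) (π : Hist S A B → PMF B)
    (pre l : List (Step S A B)) {cur t : S} (h : cur ≠ nextState l t) :
    G.histProbAux σ π pre cur l t = 0 := by
  cases l with
  | nil => exact if_neg h.symm
  | cons z rest => exact if_neg h.symm

/-- The Min strategy that plays `β` first and then follows `κ a t`, where `a` is the first
action of Max and `t` is the second state. -/
def compose (β : S → PMF B) (κ : A → S → Hist S A B → PMF B) : Hist S A B → PMF B
  | ([], u) => β u
  | (z :: l, u) => κ z.ac (nextState l u) (l, u)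

theorem isMinStrategy_compose {G : Game S A B} {β : S → PMF B} {κ : A → S → Hist S A B → PMF B}
    (hβ : ∀ u, (β u).support ⊆ G.actB u) (hκ : ∀ a t, G.IsMinStrategy (κ a t)) :
    G.IsMinStrategy (compose β κ) := by
  rintro ⟨_ | ⟨z, l⟩, u⟩
  · exact hβ u
  · exact hκ _ _ (l, u)

/-- One-step decomposition of the reachability probability when Min plays `b` first. -/
theorem reachSum_compose (G : Game S A B) (σ : Hist S A B → PMF A) {β : S → PMF B}
    (κ : A → S → Hist S A B → PMF B) {top s : S} (hs : s ≠ top) {b : B}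
    (hb : β s = PMF.pure b) :
    G.reachSum σ (compose β κ) top s =
      ∑' q : A × S, σ ([], s) q.1 * G.p s q.1 b q.2 *
        G.reachSum (fun h => σ (⟨s, q.1, b⟩ :: h.1, h.2)) (κ q.1 q.2) top q.2 := by
  let F (l : List (Step S A B)) : ℝ≥0∞ :=
    (avoidingLists top).indicator (fun l => G.histProbAux σ (compose β κ) [] s l top) l
  let e (r : A × List (Step S A B)) : List (Step S A B) := ⟨s, r.1, b⟩ :: r.2
  have he : Function.Injective e := by
    rintro ⟨a, l⟩ ⟨a', l'⟩ h
    simpa [e] using h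
  have hsupp : Function.support F ⊆ Set.range e := by
    rintro (_ | ⟨⟨x, a, b'⟩, l⟩) hl
    · refine absurd ?_ hl
      simp [F, histProbAux, hs.symm]
    · have hl' := Set.indicator_apply_ne_zero.1 hl
      have hne := hl'.2
      simp only [Function.mem_support, histProbAux] at hne
      obtain rfl : x = s := by
        by_contra hx
        simp [hx] at hne
      obtain rfl : b' = b := by
        by_contra hx
        simp [compose, hb, hx] at hne
      exact ⟨(a, l), rfl⟩
  have hF (a : A) (l : List (Step S A B)) : F (e (a, l)) =
      ∑' t, σ ([], s) a * G.p s a b t * (avoidingLists top).indicator (fun l =>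
        G.histProbAux (fun h => σ (⟨s, a, b⟩ :: h.1, h.2)) (κ a t) [] t l top) l := by
    rw [tsum_eq_single (nextState l top)]
    · by_cases hl : l ∈ avoidingLists top
      · have hl' : e (a, l) ∈ avoidingLists top := by
          intro z hz
          rcases List.mem_cons.1 hz with rfl | hz
          · exact hs
          · exact hl z hz
        simp only [F, Set.indicator_of_mem hl, Set.indicator_of_mem hl']
        simp only [e, histProbAux, compose, hb, if_true, List.nil_append, PMF.pure_apply, mul_one]
        congr 1
        refine G.histProbAux_cons_prefix _ (nextState l top) (fun _ _ _ => rfl) ?_ _ _ _ _ rfl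
        intro l' u hu
        simp [compose, hu]
      · have hl' : e (a, l) ∉ avoidingLists top :=
          fun h => hl fun z hz => h z (List.mem_cons_of_mem _ hz)
        simp only [F, Set.indicator_of_notMem hl, Set.indicator_of_notMem hl', mul_zero]
    · intro t ht
      simp [Set.indicator_apply, G.histProbAux_eq_zero _ _ _ _ ht]
  calc G.reachSum σ (compose β κ) top s = ∑' r, F (e r) := (he.tsum_eq hsupp).symm
    _ = ∑' a, ∑' l, F (e (a, l)) := ENNReal.tsum_prod'
    _ = _ := by
      rw [ENNReal.tsum_prod']
      refine tsum_congr fun a => ?_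
      simp only [hF, reachSum]
      rw [ENNReal.tsum_comm]
      exact tsum_congr fun t => ENNReal.tsum_mul_left

theorem expE_pA (G : Game S A B) (s : S) (α : PMF A) (b : B) (v : S → ℝ≥0∞) :
    expE (G.pA s α b) v = ∑' q : A × S, α q.1 * G.p s q.1 b q.2 * v q.2 := by
  rw [ENNReal.tsum_prod', ENNReal.tsum_comm]
  simp only [expE, pA, PMF.bind_apply, ENNReal.tsum_mul_right]

theorem exists_isMinStrategy (G : Game S A B) : ∃ π, G.IsMinStrategy π := by
  choose f hf using G.actB_nonempty
  exact ⟨fun h => PMF.pure (f h.2), fun h => by simpa using hf h.2⟩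

theorem iInf_le_val {G : Game S A B}
    {P : (Hist S A B → PMF A) → (Hist S A B → PMF B) → S → MeasureTheory.Measure (Play S A B)}
    {σ : Hist S A B → PMF A} (hσ : G.IsMaxStrategy σ) (E : Set (Play S A B)) (s : S) :
    ⨅ π ∈ {π | G.IsMinStrategy π}, P σ π s E ≤ G.val P E s :=
  le_iSup₂_of_le (f := fun σ (_ : σ ∈ {σ | G.IsMaxStrategy σ}) =>
    ⨅ π ∈ {π | G.IsMinStrategy π}, P σ π s E) σ hσ le_rfl

/-- A bound on what Max guarantees at `s` against all Min strategies that play `b` first is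
the expectation over the next step of what the residual strategies guarantee. -/
theorem le_tsum_iInf_of_forall_le [Countable S] [Countable A] [Countable B] (G : Game S A B)
    {P : (Hist S A B → PMF A) → (Hist S A B → PMF B) → S → MeasureTheory.Measure (Play S A B)}
    (hP : ∀ σ π s, G.IsMaxStrategy σ → G.IsMinStrategy π → G.IsPlayMeasure σ π s (P σ π s))
    {top s : S} (hs : s ≠ top) {σ : Hist S A B → PMF A} (hσ : G.IsMaxStrategy σ) {c : ℝ≥0∞}
    (hc : ∀ π, G.IsMinStrategy π → c ≤ P σ π s (Reaches top)) {b : B} (hb : b ∈ G.actB s) :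
    c ≤ ∑' q : A × S, σ ([], s) q.1 * G.p s q.1 b q.2 *
      ⨅ π ∈ {π | G.IsMinStrategy π},
        P (fun h => σ (⟨s, q.1, b⟩ :: h.1, h.2)) π q.2 (Reaches top) := by
  have hres (a : A) : G.IsMaxStrategy fun h => σ (⟨s, a, b⟩ :: h.1, h.2) :=
    fun h => hσ (⟨s, a, b⟩ :: h.1, h.2)
  have hw : ∑' q : A × S, σ ([], s) q.1 * G.p s q.1 b q.2 = 1 := by
    simpa [expE, PMF.tsum_coe] using (G.expE_pA s (σ ([], s)) b fun _ => 1).symm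
  refine ENNReal.le_of_forall_pos_le_add fun ε hε _ => ?_
  have hex (a : A) (t : S) : ∃ π, G.IsMinStrategy π ∧
      P (fun h => σ (⟨s, a, b⟩ :: h.1, h.2)) π t (Reaches top) ≤
        (⨅ π ∈ {π | G.IsMinStrategy π},
          P (fun h => σ (⟨s, a, b⟩ :: h.1, h.2)) π t (Reaches top)) + ε := by
    obtain ⟨π₀, hπ₀⟩ := G.exists_isMinStrategy
    have := (hP _ π₀ t (hres a) hπ₀).1
    have hfin : (⨅ π ∈ {π | G.IsMinStrategy π},
        P (fun h => σ (⟨s, a, b⟩ :: h.1, h.2)) π t (Reaches top)) ≠ ⊤ :=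
      ne_top_of_le_ne_top (MeasureTheory.measure_ne_top _ _) (iInf₂_le π₀ hπ₀)
    have hlt := ENNReal.lt_add_right hfin (ENNReal.coe_ne_zero.2 hε.ne')
    obtain ⟨π, hπ⟩ := iInf_lt_iff.1 hlt
    obtain ⟨hm, hlt⟩ := iInf_lt_iff.1 hπ
    exact ⟨π, hm, hlt.le⟩
  choose κ hκ hκε using hex
  choose f hf using G.actB_nonempty
  let β (u : S) : PMF B := PMF.pure (if u = s then b else f u)
  have hβ (u : S) : (β u).support ⊆ G.actB u := by
    by_cases hu : u = s
    · subst hu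
      simpa [β] using hb
    · simpa [β, hu] using hf u
  have hπ := isMinStrategy_compose hβ hκ
  calc c ≤ P σ (compose β κ) s (Reaches top) := hc _ hπ
    _ = ∑' q : A × S, σ ([], s) q.1 * G.p s q.1 b q.2 *
        P (fun h => σ (⟨s, q.1, b⟩ :: h.1, h.2)) (κ q.1 q.2) q.2 (Reaches top) := by
      rw [(hP _ _ _ hσ hπ).reaches_eq, G.reachSum_compose σ κ hs (b := b) (by simp [β])]
      exact tsum_congr fun q => by rw [(hP _ _ _ (hres q.1) (hκ q.1 q.2)).reaches_eq]
    _ ≤ ∑' q : A × S, σ ([], s) q.1 * G.p s q.1 b q.2 *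
        ((⨅ π ∈ {π | G.IsMinStrategy π},
          P (fun h => σ (⟨s, q.1, b⟩ :: h.1, h.2)) π q.2 (Reaches top)) + ε) :=
      ENNReal.tsum_le_tsum fun q => mul_le_mul_right (hκε _ _) _
    _ = _ := by simp only [mul_add, ENNReal.tsum_add, ENNReal.tsum_mul_right, hw, one_mul]

end Game

/-- the first mixed action of an optimal Max strategy is
optimality-preserving. -/
theorem stmt16 {S A B : Type} [Countable S] [Countable A] [Countable B]
    (G : Game S A B) (top : S) (htop : G.IsSink top)
    (hB : ∀ s, (G.actB s).Finite)
    (P : (Hist S A B → PMF A) → (Hist S A B → PMF B) → S →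
      MeasureTheory.Measure (Play S A B))
    (hP : ∀ σ π s, G.IsMaxStrategy σ → G.IsMinStrategy π →
      G.IsPlayMeasure σ π s (P σ π s))
    (s : S) (σ : Hist S A B → PMF A) (hσ : G.IsMaxStrategy σ)
    (hopt : ∀ π, G.IsMinStrategy π →
      G.val P (Reaches top) s ≤ P σ π s (Reaches top)) :
    ∀ b ∈ G.actB s,
      G.val P (Reaches top) s ≤
        expE (G.pA s (σ (([], s) : Hist S A B)) b) (G.val P (Reaches top)) ∧
      (expE (G.pA s (σ (([], s) : Hist S A B)) b) (G.val P (Reaches top)) =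
          G.val P (Reaches top) s →
        ∀ t ∈ (G.pA s (σ (([], s) : Hist S A B)) b).support,
          t ∈ G.OptStates P top) := by
  intro b hb
  by_cases hs : s = top
  · subst hs
    have hp : G.pA s (σ ([], s)) b = PMF.pure s := by
      have (a : A) : G.p s a b = PMF.pure s := by
        ext t
        by_cases ht : t = s
        · subst ht
          simpa using htop a b
        · rw [PMF.pure_apply_of_ne _ _ ht, PMF.apply_eq_zero_iff,
            (PMF.apply_eq_one_iff _ _).1 (htop a b)]
          exact ht
      simp [Game.pA, this]
    rw [hp]
    refine ⟨le_of_eq ?_, fun _ t ht => ?_⟩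
    · rw [expE, tsum_eq_single s fun t ht => by simp [ht]]
      simp
    · obtain rfl : t = s := by simpa using ht
      exact ⟨σ, hσ, hopt⟩
  · have hres (a : A) : G.IsMaxStrategy fun h => σ (⟨s, a, b⟩ :: h.1, h.2) :=
      fun h => hσ (⟨s, a, b⟩ :: h.1, h.2)
    have hle := G.le_tsum_iInf_of_forall_le hP hs hσ hopt hb
    have hterm (q : A × S) : σ ([], s) q.1 * G.p s q.1 b q.2 *
        (⨅ π ∈ {π | G.IsMinStrategy π},
          P (fun h => σ (⟨s, q.1, b⟩ :: h.1, h.2)) π q.2 (Reaches top)) ≤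
        σ ([], s) q.1 * G.p s q.1 b q.2 * G.val P (Reaches top) q.2 :=
      mul_le_mul_right (Game.iInf_le_val (hres q.1) _ _) _
    rw [G.expE_pA]
    refine ⟨hle.trans (ENNReal.tsum_le_tsum hterm), fun heq t ht => ?_⟩
    obtain ⟨a, ha, hat⟩ := (PMF.mem_support_bind_iff _ _ _).1 ht
    refine ⟨_, hres a, le_iInf₂_iff.1 (not_lt.1 fun hlt => ?_)⟩
    have hfin : G.val P (Reaches top) s ≠ ⊤ := by
      obtain ⟨π₀, hπ₀⟩ := G.exists_isMinStrategy
      have := (hP σ π₀ s hσ hπ₀).1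
      exact ne_top_of_le_ne_top (MeasureTheory.measure_ne_top _ _) (hopt π₀ hπ₀)
    refine absurd (ENNReal.tsum_lt_tsum (i := (a, t)) ?_ hterm ?_) (heq.trans_le hle).not_gt
    · exact ne_top_of_le_ne_top (heq.trans_ne hfin) (ENNReal.tsum_le_tsum hterm)
    · exact ENNReal.mul_lt_mul_right (mul_ne_zero ha hat)
        (ENNReal.mul_ne_top (PMF.apply_ne_top _ _) (PMF.apply_ne_top _ _)) hlt
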